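/- Let (W,S) be a finite Coxeter system, let u ∈ W with support S(u) = I, and let J be a subset of S with I ⊆ J. The map v ↦ v^I is a bijection from the set {v ∈ W : u ≤_β v and S(v) = J} to the set E_β(I,J). -/

import Mathlib

open scoped Classical

namespace ShardBHZ

variable {B : Type*} {W : Type*} [Group W] {M : CoxeterMatrix B} (cs : CoxeterSystem M W)

/-- The support `S(w)` of `w`: the set of simple reflections appearing in some
(equivalently, any) reduced word for `w`. -/
def supp (w : W) : Set B := {i | ∃ l : List B, cs.IsReduced l ∧ cs.wordProd l = w ∧ i ∈ l}

/-- The standard parabolic subgroup `W_I` generated by the simple reflections in `I`. -/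
def parab (I : Set B) : Subgroup W := Subgroup.closure (cs.simple '' I)

/-- `x` has no right descent in `I`; this characterizes the minimal length coset
representatives `W^I` of `W / W_I`. -/
def IsMinRep (I : Set B) (x : W) : Prop := ∀ i ∈ I, ¬ cs.IsRightDescent x i

/-- The BHZ order: `u ≤_β v` iff the parabolic component `v_{S(u)}` equals `u`, i.e.
`v = (v * u⁻¹) * u` is the parabolic factorization of `v` with respect to `W_{S(u)}`:
`u ∈ W_{S(u)}`, `v * u⁻¹` has no right descent in `S(u)`, and lengths add. -/
def bhzLE (u v : W) : Prop :=
  u ∈ parab cs (supp cs u) ∧ IsMinRep cs (supp cs u) (v * u⁻¹) ∧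
    cs.length v = cs.length (v * u⁻¹) + cs.length u

/-- The set `N(w)` of left inversions of `w`. -/
def invSet (w : W) : Set W := {t | cs.IsLeftInversion w t}

/-- The subgroup `G(w)` generated by `w * s * w⁻¹` for `s` a right descent of `w`. -/
def descConj (w : W) : Subgroup W :=
  Subgroup.closure {x | ∃ i, cs.IsRightDescent w i ∧ x = w * cs.simple i * w⁻¹}

/-- The shard intersection order: `u ≤_σ v` iff `N(u) ⊆ N(v)` and `G(u) ⊆ G(v)`. -/
def shardLE (u v : W) : Prop := invSet cs u ⊆ invSet cs v ∧ descConj cs u ≤ descConj cs v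

/-- The parabolic component `w_I ∈ W_I` of `w` in the unique factorization
`w = w^I * w_I` with `w_I ∈ W_I`, `ℓ(w) = ℓ(w^I) + ℓ(w_I)` and `w^I` having no right
descent in `I`. -/
noncomputable def pLow (I : Set B) (w : W) : W :=
  Classical.epsilon (fun u => u ∈ parab cs I ∧ IsMinRep cs I (w * u⁻¹) ∧
    cs.length w = cs.length (w * u⁻¹) + cs.length u)

/-- The minimal length coset representative `w^I = w * (w_I)⁻¹`. -/
noncomputable def pHigh (I : Set B) (w : W) : W := w * (pLow cs I w)⁻¹

/-- `E_β(I,J) = {u ∈ W_J : u has no right descent in I and J \ I ⊆ S(u)}`. -/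
def Eb (I J : Set B) : Set W :=
  {u | u ∈ parab cs J ∧ IsMinRep cs I u ∧ J \ I ⊆ supp cs u}

/-- `E_σ(I,J) = {w ∈ W_J : S(w) = J and I ⊆ D_R(w) ⊆ J}`. -/
def Es (I J : Set B) : Set W :=
  {w | w ∈ parab cs J ∧ supp cs w = J ∧ (∀ i ∈ I, cs.IsRightDescent w i) ∧
    ∀ i : B, cs.IsRightDescent w i → i ∈ J}

section GeometricRepresentation

open Module

/-- The functional `v ↦ 2 B(α_i, v)` on the geometric representation of a Coxeter matrix. -/
noncomputable def geomCoroot (M : CoxeterMatrix B) (i : B) : Dual ℝ (B →₀ ℝ) :=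
  Finsupp.linearCombination ℝ fun j => -2 * Real.cos (Real.pi / M i j)

lemma geomCoroot_single (M : CoxeterMatrix B) (i j : B) :
    geomCoroot M i (Finsupp.single j 1) = -2 * Real.cos (Real.pi / M i j) := by
  simp [geomCoroot]

lemma geomCoroot_single_self (M : CoxeterMatrix B) (i : B) :
    geomCoroot M i (Finsupp.single i 1) = 2 := by
  simp [geomCoroot_single]

/-- The reflection by which a simple generator acts in the geometric representation. -/
noncomputable def geomReflection (M : CoxeterMatrix B) (i : B) : (B →₀ ℝ) ≃ₗ[ℝ] (B →₀ ℝ) :=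
  reflection (geomCoroot_single_self M i)

lemma eval_chebyshev_S_two_mul_cos_eq_zero {m : ℕ} (hm : 3 ≤ m) :
    ((Polynomial.Chebyshev.S ℝ ((m - 2) / 2)).eval (2 * Real.cos (2 * (Real.pi / m))) *
      ((Polynomial.Chebyshev.S ℝ ((m - 1) / 2)).eval (2 * Real.cos (2 * (Real.pi / m))) +
        (Polynomial.Chebyshev.S ℝ ((m - 3) / 2)).eval (2 * Real.cos (2 * (Real.pi / m)))) = 0) ∧
    ((Polynomial.Chebyshev.S ℝ ((m - 1) / 2)).eval (2 * Real.cos (2 * (Real.pi / m))) *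
      ((Polynomial.Chebyshev.S ℝ (m / 2)).eval (2 * Real.cos (2 * (Real.pi / m))) +
        (Polynomial.Chebyshev.S ℝ ((m - 2) / 2)).eval (2 * Real.cos (2 * (Real.pi / m)))) = 0) := by
  have hm0 : (0 : ℝ) < m := by positivity
  have hmθ : (m : ℝ) * (Real.pi / m) = Real.pi := by field_simp
  set θ := Real.pi / m
  have hsin : Real.sin (2 * θ) ≠ 0 := by
    have hθ : 0 < θ := by positivity
    have h3 : (3 : ℝ) ≤ m := by exact_mod_cast hm
    exact (Real.sin_pos_of_pos_of_lt_pi (by positivity) (by nlinarith)).ne'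
  have hS (k : ℤ) := Polynomial.Chebyshev.S_two_mul_real_cos (2 * θ) k
  obtain ⟨p, rfl | rfl⟩ := Nat.even_or_odd' m
  · have h0 : (Polynomial.Chebyshev.S ℝ ((p : ℤ) - 1)).eval (2 * Real.cos (2 * θ)) = 0 := by
      refine (mul_eq_zero.mp ((hS _).trans ?_)).resolve_right hsin
      push_cast at hmθ ⊢
      rw [show ((p : ℝ) - 1 + 1) * (2 * θ) = Real.pi by linarith, Real.sin_pi]
    rw [show (((2 * p : ℕ) : ℤ) - 2) / 2 = p - 1 by omega,
      show (((2 * p : ℕ) : ℤ) - 1) / 2 = p - 1 by omega, h0]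
    simp
  · have h0 : (Polynomial.Chebyshev.S ℝ (p : ℤ)).eval (2 * Real.cos (2 * θ)) +
        (Polynomial.Chebyshev.S ℝ ((p : ℤ) - 1)).eval (2 * Real.cos (2 * θ)) = 0 := by
      refine (mul_eq_zero.mp (?_ : _ * Real.sin (2 * θ) = 0)).resolve_right hsin
      rw [add_mul, hS, hS]
      push_cast at hmθ ⊢
      rw [show ((p : ℝ) + 1) * (2 * θ) = 2 * Real.pi - ((p : ℝ) - 1 + 1) * (2 * θ) by linarith,
        Real.sin_two_pi_sub]
      ring
    rw [show (((2 * p + 1 : ℕ) : ℤ) - 2) / 2 = p - 1 by omega,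
      show (((2 * p + 1 : ℕ) : ℤ) - 1) / 2 = p by omega,
      show (((2 * p + 1 : ℕ) : ℤ) - 3) / 2 = p - 1 by omega,
      show (((2 * p + 1 : ℕ) : ℤ)) / 2 = p by omega, h0]
    simp

lemma isLiftable_geomReflection (M : CoxeterMatrix B) : M.IsLiftable (geomReflection M) := by
  intro i j
  rcases eq_or_ne i j with rfl | hij
  · rw [M.diagonal, pow_one]
    exact LinearEquiv.ext fun z => involutive_reflection (geomCoroot_single_self M i) z
  have h1 := M.off_diagonal i j hij
  have hsymm : M j i = M i j := M.symmetric j i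
  apply LinearEquiv.ext
  intro z
  rcases Nat.lt_or_ge (M i j) 3 with hlt | hge
  · obtain h0 | h2 : M i j = 0 ∨ M i j = 2 := by omega
    · simp [h0]
    · have hc (a b : B) (hab : M a b = 2) : geomCoroot M a (Finsupp.single b 1) = 0 := by
        simp [geomCoroot_single, hab]
      simp only [h2, pow_two, LinearEquiv.mul_apply, LinearEquiv.coe_one, id, geomReflection,
        reflection_apply, map_sub, map_smul, geomCoroot_single_self, hc i j h2,
        hc j i (hsymm.trans h2)]
      module
  · have ht : 2 * Real.cos (2 * (Real.pi / M i j)) =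
        geomCoroot M i (Finsupp.single j 1) * geomCoroot M j (Finsupp.single i 1) - 2 := by
      rw [geomCoroot_single, geomCoroot_single, hsymm, Real.cos_two_mul]
      ring
    obtain ⟨h₁, h₂⟩ := eval_chebyshev_S_two_mul_cos_eq_zero hge
    rw [geomReflection, geomReflection, reflection_mul_reflection_pow_apply _ _ _ _ _ ht, h₁, h₂]
    simp

lemma simple_injective : Function.Injective cs.simple := by
  intro i j h
  by_contra hij
  have h1 := congrArg (cs.lift ⟨geomReflection M, isLiftable_geomReflection M⟩) h
  rw [cs.lift_apply_simple, cs.lift_apply_simple] at h1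
  have h2 := congrArg (fun r : (B →₀ ℝ) ≃ₗ[ℝ] (B →₀ ℝ) => r (Finsupp.single i 1) i) h1
  simp only [geomReflection, reflection_apply, geomCoroot_single_self] at h2
  simp [Ne.symm hij] at h2

end GeometricRepresentation

section Exchange

/-- The action of a simple reflection on `W × ZMod 2` counting, modulo two, the occurrences of an
element in right inversion sequences. -/
noncomputable def inversionAct (i : B) : Function.End (W × ZMod 2) :=
  fun p => (cs.simple i * p.1 * cs.simple i, p.2 + if p.1 = cs.simple i then 1 else 0)

lemma inversionAct_apply (i : B) (p : W × ZMod 2) : inversionAct cs i p =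
    (cs.simple i * p.1 * cs.simple i, p.2 + if p.1 = cs.simple i then 1 else 0) := rfl

lemma simple_mul_simple_mul_pow (i j : B) (n : ℕ) :
    cs.simple j * (cs.simple i * cs.simple j) ^ n =
      ((cs.simple i * cs.simple j) ^ n)⁻¹ * cs.simple j := by
  have h : SemiconjBy (cs.simple j) (cs.simple i * cs.simple j) (cs.simple i * cs.simple j)⁻¹ := by
    simp [SemiconjBy, mul_assoc]
  rw [← inv_pow]
  exact (h.pow_right n).eq

lemma inversionAct_mul_pow_apply (i j : B) (n : ℕ) (p : W × ZMod 2) :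
    ((inversionAct cs i * inversionAct cs j) ^ n) p =
      ((cs.simple i * cs.simple j) ^ n * p.1 * ((cs.simple i * cs.simple j) ^ n)⁻¹,
        p.2 + ∑ k ∈ Finset.range (2 * n),
          if p.1 = cs.simple j * (cs.simple i * cs.simple j) ^ k then 1 else 0) := by
  induction n with
  | zero => simp; rfl
  | succ n ih =>
    have hconj := simple_mul_simple_mul_pow cs i j n
    rw [pow_succ']
    change inversionAct cs i (inversionAct cs j (((inversionAct cs i * inversionAct cs j) ^ n) p)) =
      _
    rw [ih, inversionAct_apply, inversionAct_apply, mul_add, mul_one, Finset.sum_range_succ,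
      Finset.sum_range_succ]
    have hd : (cs.simple i * cs.simple j)⁻¹ = cs.simple j * cs.simple i := by simp
    set d := cs.simple i * cs.simple j with hd'
    have e1 : d ^ n * p.1 * (d ^ n)⁻¹ = cs.simple j ↔ p.1 = cs.simple j * d ^ (2 * n) := by
      rw [two_mul, pow_add, ← mul_assoc, hconj, mul_inv_eq_iff_eq_mul, mul_assoc,
        eq_inv_mul_iff_mul_eq]
    have e2 : cs.simple j * (d ^ n * p.1 * (d ^ n)⁻¹) * cs.simple j = cs.simple i ↔
        p.1 = cs.simple j * d ^ (2 * n + 1) := by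
      have h : cs.simple j * d ^ (2 * n + 1) =
          (d ^ n)⁻¹ * (cs.simple j * cs.simple i * cs.simple j) * d ^ n := by
        rw [show 2 * n + 1 = n + (1 + n) by ring, pow_add, ← mul_assoc, hconj, pow_add, pow_one]
        simp [hd', mul_assoc]
      rw [h]
      constructor
      · intro h'
        simp [← h', mul_assoc]
      · intro h'
        simp [h', mul_assoc]
    refine Prod.ext ?_ ?_
    · simp only [pow_succ', mul_inv_rev, hd]
      simp [hd', mul_assoc]
    · simp only [e1, e2, add_assoc]

lemma isLiftable_inversionAct : M.IsLiftable (inversionAct cs) := by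
  intro i j
  funext p
  have hd := cs.simple_mul_simple_pow i j
  rw [inversionAct_mul_pow_apply, two_mul, Finset.sum_range_add]
  simp only [pow_add, hd, one_mul, inv_one, mul_one, CharTwo.add_self_eq_zero, add_zero]
  rfl

lemma lift_inversionAct_wordProd (ω : List B) (p : W × ZMod 2) :
    cs.lift ⟨inversionAct cs, isLiftable_inversionAct cs⟩ (cs.wordProd ω) p =
      (cs.wordProd ω * p.1 * (cs.wordProd ω)⁻¹, p.2 + (cs.rightInvSeq ω).count p.1) := by
  induction ω with
  | nil => simp; rfl
  | cons i ω ih =>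
    rw [cs.wordProd_cons, map_mul, cs.lift_apply_simple]
    change inversionAct cs i
      (cs.lift ⟨inversionAct cs, isLiftable_inversionAct cs⟩ (cs.wordProd ω) p) = _
    have h : cs.wordProd ω * p.1 * (cs.wordProd ω)⁻¹ = cs.simple i ↔
        (cs.wordProd ω)⁻¹ * cs.simple i * cs.wordProd ω = p.1 := by
      rw [mul_inv_eq_iff_eq_mul, mul_assoc, inv_mul_eq_iff_eq_mul, eq_comm]
    rw [ih, inversionAct_apply, CoxeterSystem.rightInvSeq, List.count_cons]
    simp only [h, beq_iff_eq]
    refine Prod.ext ?_ ?_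
    · simp [mul_assoc]
    · push_cast
      rw [add_assoc]

lemma count_rightInvSeq_eq_of_wordProd_eq {ω ω' : List B}
    (h : cs.wordProd ω = cs.wordProd ω') (t : W) :
    ((cs.rightInvSeq ω).count t : ZMod 2) = (cs.rightInvSeq ω').count t := by
  have h1 := lift_inversionAct_wordProd cs ω (t, 0)
  rw [h, lift_inversionAct_wordProd] at h1
  simpa using (congrArg Prod.snd h1).symm

lemma simple_mem_rightInvSeq {ω : List B} {i : B} (h : cs.IsRightDescent (cs.wordProd ω) i) :
    cs.simple i ∈ cs.rightInvSeq ω := by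
  by_contra hmem
  obtain ⟨α, hα, hαω⟩ := cs.exists_isReduced (cs.wordProd ω * cs.simple i)
  have hprod : cs.wordProd (α.concat i) = cs.wordProd ω := by
    rw [cs.wordProd_concat, ← hαω, cs.simple_mul_simple_cancel_right]
  have hcount := count_rightInvSeq_eq_of_wordProd_eq cs hprod (cs.simple i)
  have hconj (l : List W) : (l.map (MulAut.conj (cs.simple i))).count (cs.simple i) =
      l.count (cs.simple i) := by
    simpa using l.count_map_of_injective _ (MulAut.conj (cs.simple i)).injective (cs.simple i)
  rw [cs.rightInvSeq_concat, List.count_eq_zero_of_not_mem hmem, List.concat_eq_append,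
    List.count_append, List.count_singleton_self, hconj] at hcount
  by_cases hmem' : cs.simple i ∈ cs.rightInvSeq α
  · have h2 := (cs.isRightInversion_of_mem_rightInvSeq hα hmem').2
    rw [← hαω, cs.simple_mul_simple_cancel_right] at h2
    exact lt_asymm h h2
  · rw [List.count_eq_zero_of_not_mem hmem'] at hcount
    simp at hcount

/-- The exchange condition. -/
lemma exists_wordProd_eraseIdx_eq {ω : List B} {i : B}
    (h : cs.IsRightDescent (cs.wordProd ω) i) :
    ∃ k < ω.length, cs.wordProd (ω.eraseIdx k) = cs.wordProd ω * cs.simple i := by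
  obtain ⟨k, hk, hki⟩ := List.mem_iff_getElem.mp (simple_mem_rightInvSeq cs h)
  refine ⟨k, cs.length_rightInvSeq ω ▸ hk, ?_⟩
  rw [← cs.wordProd_mul_getD_rightInvSeq, List.getD_eq_getElem _ 1 hk, hki]

/-- Multiplying a reduced word by a simple reflection on the right gives an element that has a
reduced word using no further letters. -/
lemma exists_isReduced_mul_simple {ω : List B} (hω : cs.IsReduced ω) (i : B) :
    ∃ ω' : List B, cs.IsReduced ω' ∧ cs.wordProd ω' = cs.wordProd ω * cs.simple i ∧
      ∀ j ∈ ω', j ∈ ω ∨ j = i := by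
  by_cases hi : cs.IsRightDescent (cs.wordProd ω) i
  · obtain ⟨k, hk, hprod⟩ := exists_wordProd_eraseIdx_eq cs hi
    refine ⟨ω.eraseIdx k, ?_, hprod, fun j hj => Or.inl (List.mem_of_mem_eraseIdx hj)⟩
    have h1 := List.length_eraseIdx_add_one hk
    have h2 := cs.isRightDescent_iff.mp hi
    have h3 := hω.eq
    rw [CoxeterSystem.IsReduced, hprod]
    omega
  · refine ⟨ω ++ [i], ?_, by simp [cs.wordProd_append], by simp⟩
    rw [CoxeterSystem.IsReduced, cs.wordProd_append, cs.wordProd_singleton,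
      cs.not_isRightDescent_iff.mp hi, hω.eq, List.length_append, List.length_singleton]

end Exchange

section Parabolic

variable {I : Set B} {u w x y : W}

lemma simple_mem_parab {i : B} (hi : i ∈ I) : cs.simple i ∈ parab cs I :=
  Subgroup.subset_closure ⟨i, hi, rfl⟩

lemma wordProd_mem_parab {ω : List B} (h : ∀ i ∈ ω, i ∈ I) : cs.wordProd ω ∈ parab cs I := by
  refine Subgroup.list_prod_mem _ fun x hx => ?_
  obtain ⟨i, hi, rfl⟩ := List.mem_map.mp hx
  exact simple_mem_parab cs (h i hi)

lemma exists_isReduced_of_mem_parab (hw : w ∈ parab cs I) :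
    ∃ ω : List B, cs.IsReduced ω ∧ cs.wordProd ω = w ∧ ∀ i ∈ ω, i ∈ I := by
  have step (x : W) (i : B) (hi : i ∈ I)
      (h : ∃ ω : List B, cs.IsReduced ω ∧ cs.wordProd ω = x ∧ ∀ i ∈ ω, i ∈ I) :
      ∃ ω : List B, cs.IsReduced ω ∧ cs.wordProd ω = x * cs.simple i ∧ ∀ i ∈ ω, i ∈ I := by
    obtain ⟨ω, hω, rfl, hωI⟩ := h
    obtain ⟨ω', hω', hprod, hsub⟩ := exists_isReduced_mul_simple cs hω i
    exact ⟨ω', hω', hprod, fun j hj => (hsub j hj).elim (hωI j) fun h => h ▸ hi⟩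
  induction hw using Subgroup.closure_induction_right with
  | one => exact ⟨[], by simp [CoxeterSystem.IsReduced], by simp, by simp⟩
  | mul_right x hx y hy ih =>
    obtain ⟨i, hi, rfl⟩ := hy
    exact step x i hi ih
  | mul_inv_cancel x hx y hy ih =>
    obtain ⟨i, hi, rfl⟩ := hy
    rw [cs.inv_simple]
    exact step x i hi ih

lemma mem_of_simple_mem_parab {i : B} (h : cs.simple i ∈ parab cs I) : i ∈ I := by
  obtain ⟨ω, hω, hprod, hωI⟩ := exists_isReduced_of_mem_parab cs h
  have hlen := hω.eq
  rw [hprod, cs.length_simple] at hlen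
  obtain ⟨j, rfl⟩ := List.length_eq_one_iff.mp hlen.symm
  rw [cs.wordProd_singleton] at hprod
  exact simple_injective cs hprod ▸ hωI j (by simp)

lemma mem_of_mem_parab {ω : List B} (hω : cs.IsReduced ω) (h : cs.wordProd ω ∈ parab cs I) :
    ∀ i ∈ ω, i ∈ I := by
  induction ω using List.reverseRecOn with
  | nil => simp
  | append_singleton ω i ih =>
    have hω' : cs.IsReduced ω := by simpa using hω.take ω.length
    have hdesc : cs.IsRightDescent (cs.wordProd (ω ++ [i])) i := by
      rw [CoxeterSystem.IsRightDescent, hω.eq, cs.wordProd_append, cs.wordProd_singleton,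
        cs.simple_mul_simple_cancel_right, hω'.eq]
      simp
    obtain ⟨α, hα, hαω, hαI⟩ := exists_isReduced_of_mem_parab cs h
    rw [← hαω] at hdesc
    obtain ⟨k, -, hprod⟩ := exists_wordProd_eraseIdx_eq cs hdesc
    have hmem := wordProd_mem_parab cs (ω := α.eraseIdx k) fun j hj =>
      hαI j (List.mem_of_mem_eraseIdx hj)
    have hi : cs.simple i ∈ parab cs I := by
      rw [hprod] at hmem
      exact (Subgroup.mul_mem_cancel_left _ (hαω ▸ h)).mp hmem
    rw [cs.wordProd_append, cs.wordProd_singleton, Subgroup.mul_mem_cancel_right _ hi] at h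
    intro j hj
    rcases List.mem_append.mp hj with hj | hj
    · exact ih hω' h j hj
    · rw [List.mem_singleton.mp hj]
      exact mem_of_simple_mem_parab cs hi

lemma mem_parab_iff_supp_subset : w ∈ parab cs I ↔ supp cs w ⊆ I := by
  constructor
  · rintro h i ⟨ω, hω, rfl, hi⟩
    exact mem_of_mem_parab cs hω h i hi
  · intro h
    obtain ⟨ω, hω, rfl⟩ := cs.exists_isReduced w
    exact wordProd_mem_parab cs fun i hi => h ⟨ω, hω, rfl, hi⟩

lemma supp_mul (h : cs.length (x * y) = cs.length x + cs.length y) :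
    supp cs (x * y) = supp cs x ∪ supp cs y := by
  apply Set.Subset.antisymm
  · rw [← mem_parab_iff_supp_subset]
    exact mul_mem ((mem_parab_iff_supp_subset cs).mpr Set.subset_union_left)
      ((mem_parab_iff_supp_subset cs).mpr Set.subset_union_right)
  · have hred {α β : List B} (hα : cs.IsReduced α) (hβ : cs.IsReduced β)
        (h : cs.length (cs.wordProd α * cs.wordProd β) =
          cs.length (cs.wordProd α) + cs.length (cs.wordProd β)) : cs.IsReduced (α ++ β) := by
      rw [CoxeterSystem.IsReduced, cs.wordProd_append, h, hα.eq, hβ.eq, List.length_append]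
    rintro i (⟨α, hα, rfl, hi⟩ | ⟨β, hβ, rfl, hi⟩)
    · obtain ⟨β, hβ, rfl⟩ := cs.exists_isReduced y
      exact ⟨α ++ β, hred hα hβ h, cs.wordProd_append α β, List.mem_append_left _ hi⟩
    · obtain ⟨α, hα, rfl⟩ := cs.exists_isReduced x
      exact ⟨α ++ β, hred hα hβ h, cs.wordProd_append α β, List.mem_append_right _ hi⟩

lemma rightInvSeq_append (α β : List B) : cs.rightInvSeq (α ++ β) =
    (cs.rightInvSeq α).map (MulAut.conj (cs.wordProd β)⁻¹) ++ cs.rightInvSeq β := by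
  induction α with
  | nil => simp
  | cons i α ih => simp [CoxeterSystem.rightInvSeq, ih, cs.wordProd_append, mul_assoc]

lemma length_mul_of_forall_length_le (hx : ∀ y ∈ parab cs I, cs.length x ≤ cs.length (x * y))
    (hy : y ∈ parab cs I) : cs.length (x * y) = cs.length x + cs.length y := by
  obtain ⟨ω, hω, rfl, hωI⟩ := exists_isReduced_of_mem_parab cs hy
  clear hy
  induction ω using List.reverseRecOn with
  | nil => simp
  | append_singleton ω i ih =>
    have hω' : cs.IsReduced ω := by simpa using hω.take ω.length
    have hωI' : ∀ j ∈ ω, j ∈ I := fun j hj => hωI j (List.mem_append_left _ hj)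
    have hlen := ih hω' hωI'
    suffices h : ¬ cs.IsRightDescent (x * cs.wordProd ω) i by
      rw [hω.eq, cs.wordProd_append, cs.wordProd_singleton, ← mul_assoc,
        cs.not_isRightDescent_iff.mp h, hlen, hω'.eq, List.length_append, List.length_singleton,
        add_assoc]
    intro h
    obtain ⟨α, hα, rfl⟩ := cs.exists_isReduced x
    rw [← cs.wordProd_append] at h
    have hmem := simple_mem_rightInvSeq cs h
    rw [rightInvSeq_append, List.mem_append, List.mem_map] at hmem
    rcases hmem with ⟨t, ht, hti⟩ | hmem
    · have ht' : t = cs.wordProd ω * cs.simple i * (cs.wordProd ω)⁻¹ := by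
        rw [← hti]
        simp [mul_assoc]
      have hωmem := wordProd_mem_parab cs hωI'
      have htI : t ∈ parab cs I := by
        rw [ht']
        exact mul_mem (mul_mem hωmem (simple_mem_parab cs (hωI i (by simp)))) (inv_mem hωmem)
      exact (hx t htI).not_gt (cs.isRightInversion_of_mem_rightInvSeq hα ht).2
    · have h1 := (cs.isRightInversion_of_mem_rightInvSeq hω' hmem).2
      have h2 := hω.eq
      rw [cs.wordProd_append, cs.wordProd_singleton, List.length_append, ← hω'.eq] at h2
      omega

lemma exists_isRightDescent_of_mem_parab (hy : y ∈ parab cs I) (h1 : y ≠ 1) :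
    ∃ i ∈ I, cs.IsRightDescent y i := by
  obtain ⟨i, hi⟩ := cs.exists_rightDescent_of_ne_one h1
  refine ⟨i, ?_, hi⟩
  obtain ⟨ω, hω, hprod⟩ := cs.exists_isReduced (y * cs.simple i)
  have hred : cs.IsReduced (ω ++ [i]) := by
    rw [CoxeterSystem.IsReduced, cs.wordProd_append, cs.wordProd_singleton, ← hprod,
      cs.simple_mul_simple_cancel_right, List.length_append, ← hω.eq, ← hprod]
    exact (cs.isRightDescent_iff.mp hi).symm
  refine mem_of_mem_parab cs hred ?_ i (by simp)
  rwa [cs.wordProd_append, cs.wordProd_singleton, ← hprod, cs.simple_mul_simple_cancel_right]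

lemma IsMinRep.length_le (hx : IsMinRep cs I x) (hy : y ∈ parab cs I) :
    cs.length x ≤ cs.length (x * y) := by
  obtain ⟨z, hz, hmin⟩ := WellFounded.has_min (measure fun z => cs.length (x * z)).wf
    (parab cs I : Set W) ⟨1, one_mem _⟩
  have hmin' : ∀ y ∈ parab cs I, cs.length (x * z) ≤ cs.length (x * z * y) := fun y hy => by
    rw [mul_assoc]
    exact not_lt.mp (hmin _ (mul_mem hz hy))
  by_cases hz1 : z⁻¹ = 1
  · rw [inv_eq_one.mp hz1, mul_one] at hmin'
    exact hmin' y hy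
  · obtain ⟨i, hi, hdesc⟩ := exists_isRightDescent_of_mem_parab cs (inv_mem hz) hz1
    refine absurd ?_ (hx i hi)
    have h1 := length_mul_of_forall_length_le cs hmin' (inv_mem hz)
    have h2 := cs.length_mul_le (x * z) (z⁻¹ * cs.simple i)
    rw [mul_inv_cancel_right] at h1
    rw [← mul_assoc, mul_inv_cancel_right] at h2
    rw [CoxeterSystem.IsRightDescent] at hdesc ⊢
    omega

lemma IsMinRep.length_mul (hx : IsMinRep cs I x) (hy : y ∈ parab cs I) :
    cs.length (x * y) = cs.length x + cs.length y :=
  length_mul_of_forall_length_le cs (fun _ => hx.length_le) hy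

lemma pLow_mul (hx : IsMinRep cs I x) (hu : u ∈ parab cs I) : pLow cs I (x * u) = u := by
  have hspec : pLow cs I (x * u) ∈ parab cs I ∧ IsMinRep cs I (x * u * (pLow cs I (x * u))⁻¹) ∧ _ :=
    Classical.epsilon_spec
      (p := fun y => y ∈ parab cs I ∧ IsMinRep cs I (x * u * y⁻¹) ∧
        cs.length (x * u) = cs.length (x * u * y⁻¹) + cs.length y)
      ⟨u, hu, by rwa [mul_inv_cancel_right], by rw [mul_inv_cancel_right, hx.length_mul cs hu]⟩
  obtain ⟨hy, hmin, -⟩ := hspec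
  set y := pLow cs I (x * u)
  have hmem : u * y⁻¹ ∈ parab cs I := mul_mem hu (inv_mem hy)
  have h1 := hx.length_mul cs hmem
  have h2 := hmin.length_mul cs (inv_mem hmem)
  rw [← mul_assoc] at h1
  rw [mul_assoc x, mul_inv_cancel_right, cs.length_inv, ← mul_assoc] at h2
  exact (mul_inv_eq_one.mp (cs.length_eq_zero_iff.mp (by omega))).symm

lemma pHigh_mul (hx : IsMinRep cs I x) (hu : u ∈ parab cs I) : pHigh cs I (x * u) = x := by
  rw [pHigh, pLow_mul cs hx hu, mul_inv_cancel_right]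

end Parabolic

/-- For `u` of support `I` and `I ⊆ J ⊆ S`, the set of `v` with `u ≤_β v` and
`S(v) = J` is in bijection with `E_β(I,J)` via `v ↦ v^I`. -/
theorem last_step_bhz [Finite W] (u : W) (I J : Set B) (hI : supp cs u = I)
    (hIJ : I ⊆ J) :
    Set.BijOn (pHigh cs I) {v : W | bhzLE cs u v ∧ supp cs v = J} (Eb cs I J) := by
  have hu : u ∈ parab cs I := (mem_parab_iff_supp_subset cs).mpr hI.subset
  have hpHigh {v : W} (hv : bhzLE cs u v) : pHigh cs I v = v * u⁻¹ := by
    have h := pHigh_mul cs (hI ▸ hv.2.1) hu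
    rwa [inv_mul_cancel_right] at h
  refine ⟨?_, ?_, ?_⟩
  · rintro v ⟨hv, hvJ⟩
    have hsupp : J = supp cs (v * u⁻¹) ∪ I := by
      rw [← hI, ← supp_mul cs (by rw [inv_mul_cancel_right, hv.2.2]), inv_mul_cancel_right, hvJ]
    rw [hpHigh hv]
    refine ⟨?_, hI ▸ hv.2.1, ?_⟩
    · exact (mem_parab_iff_supp_subset cs).mpr (hsupp ▸ Set.subset_union_left)
    · rw [hsupp, Set.sdiff_subset_iff, Set.union_comm]
  · rintro v ⟨hv, -⟩ v' ⟨hv', -⟩ h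
    rw [hpHigh hv, hpHigh hv'] at h
    exact mul_right_cancel h
  · rintro x ⟨hxJ, hx, hJx⟩
    have hlen := hx.length_mul cs hu
    refine ⟨x * u, ⟨⟨hI.symm ▸ hu, ?_, ?_⟩, ?_⟩, pHigh_mul cs hx hu⟩
    · rwa [mul_inv_cancel_right, hI]
    · rw [mul_inv_cancel_right, hlen]
    · rw [supp_mul cs hlen, hI]
      refine Set.Subset.antisymm
        (Set.union_subset ((mem_parab_iff_supp_subset cs).mp hxJ) hIJ) ?_
      rwa [Set.union_comm, ← Set.sdiff_subset_iff]

end ShardBHZ
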